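/- Let M be a Noetherian (t−1)-invertible t-unipotent Λ-module. Then the Betti number of M, i.e., the dimension of the ℚ-vector space M ⊗_ℤ ℚ (equivalently, the rank of the free part of M as a finitely generated abelian group), is an even number. -/

import Mathlib

open Polynomial TensorProduct

/-- `Λ` is the ring `ℤ[t,t⁻¹]` of Laurent polynomials with integer coefficients. -/
abbrev Λ : Type := LaurentPolynomial ℤ

/-- `tL` is the element `t` of `Λ = ℤ[t,t⁻¹]`. -/
noncomputable def tL : Λ := LaurentPolynomial.T 1

lemma real_even_degree (n : ℕ) : ∀ f : ℝ[X], IsMonicOfDegree f n → (∀ x, ¬ f.IsRoot x) → Even n := by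
  induction n using Nat.strong_induction_on with
  | _ n ih =>
    intro f hf hr
    match n, ih, hf with
    | 0, _, _ => exact ⟨0, rfl⟩
    | 1, _, hf =>
      exfalso
      obtain ⟨r, hr'⟩ := isMonicOfDegree_one_iff.mp hf
      exact hr (-r) (by simp [hr'])
    | n + 2, ih, hf =>
      obtain ⟨f₁, f₂, h1, h2, h⟩ := hf.eq_isMonicOfDegree_two_mul_isMonicOfDegree
      have := ih n (by omega) f₂ h2 (fun x hx => hr x (by rw [h]; simp_all [IsRoot]))
      exact this.add even_two

/-- The action of `Λ` on the real vector space `ℝ ⊗ M`. -/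
noncomputable def actR (M : Type) [AddCommGroup M] [Module Λ M] :
    Λ →+* Module.End ℝ (ℝ ⊗[ℤ] M) :=
  (Module.End.baseChangeHom ℤ ℝ M).toRingHom.comp (Module.toModuleEnd ℤ (S := Λ) M)

lemma actR_tmul (M : Type) [AddCommGroup M] [Module Λ M] (q : Λ) (a : ℝ) (m : M) :
    actR M q (a ⊗ₜ m) = a ⊗ₜ (q • m) := by
  rfl

lemma actR_eq_zero (M : Type) [AddCommGroup M] [Module Λ M] (q : Λ) (h : ∀ m : M, q • m = 0) :
    actR M q = 0 := by
  ext m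
  simp [actR_tmul, h]

lemma actR_scalar (M : Type) [AddCommGroup M] [Module Λ M] (u : ℤˣ) (v : ℝ ⊗[ℤ] M)
    (hv : actR M tL v = ((u : ℤ) : ℝ) • v) (q : Λ) : ∃ c : ℤ, actR M q v = (c : ℝ) • v := by
  have hinv : actR M (LaurentPolynomial.T (-1)) v = ((u : ℤ) : ℝ) • v := by
    have h1 : actR M (LaurentPolynomial.T (-1)) (actR M tL v) = v := by
      rw [← Module.End.mul_apply, ← map_mul, tL, ← LaurentPolynomial.T_add]
      simp
    rw [hv, map_smul] at h1
    rcases Int.units_eq_one_or u with rfl | rfl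
    · simpa using h1
    · simp at h1 ⊢
      exact neg_eq_iff_eq_neg.mp h1
  have step : ∀ p : Λ, ∀ c : ℤ, ∀ w : Λ, actR M w v = ((u : ℤ) : ℝ) • v →
      actR M p v = (c : ℝ) • v → ∃ c : ℤ, actR M (p * w) v = (c : ℝ) • v := by
    intro p c w hw hp
    refine ⟨u * c, ?_⟩
    rw [map_mul, Module.End.mul_apply, hw, map_smul, hp, smul_smul]
    push_cast; rfl
  induction q using LaurentPolynomial.induction_on with
  | h_C a => 
    refine ⟨a, ?_⟩
    have : (LaurentPolynomial.C a : Λ) = (a : Λ) := by simp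
    rw [this, map_intCast]
    simp [Int.cast_smul_eq_zsmul]
  | h_add hp hq =>
    obtain ⟨a, ha⟩ := hp
    obtain ⟨b, hb⟩ := hq
    exact ⟨a + b, by simp [ha, hb, add_smul]⟩
  | h_C_mul_T n a h =>
    obtain ⟨c, hc⟩ := h
    rw [LaurentPolynomial.T_add, ← mul_assoc]
    exact step _ c _ hv hc
  | h_C_mul_T_Z n a h =>
    obtain ⟨c, hc⟩ := h
    rw [sub_eq_add_neg, LaurentPolynomial.T_add, ← mul_assoc]
    exact step _ c _ hinv hc

lemma no_eigen (M : Type) [AddCommGroup M] [Module Λ M] [IsNoetherian Λ M]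
    (hM : Function.Bijective (fun v : M => (tL - 1) • v)) (u : ℤˣ) (v : ℝ ⊗[ℤ] M)
    (hv : actR M tL v = ((u : ℤ) : ℝ) • v) : v = 0 := by
  obtain ⟨r, hr, hr0⟩ := Submodule.exists_sub_one_mem_and_smul_eq_zero_of_fg_of_le_smul
    (Ideal.span {tL - 1}) (⊤ : Submodule Λ M) (IsNoetherian.noetherian _) (by
      intro m _
      obtain ⟨m', rfl⟩ := hM.2 m
      exact Submodule.smul_mem_smul (Ideal.subset_span rfl) trivial)
  obtain ⟨s, hs⟩ := Ideal.mem_span_singleton'.mp hr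
  have hr' : r = s * (tL - 1) + 1 := by rw [hs]; ring
  have h0 := actR_eq_zero M r (fun m => hr0 m trivial)
  obtain ⟨c, hc⟩ := actR_scalar M u v hv s
  have h1 : actR M r v = (((u - 1) * c + 1 : ℤ) : ℝ) • v := by
    have : actR M (tL - 1) v = ((u : ℤ) - 1 : ℝ) • v := by
      simp [hv, sub_smul]
    rw [hr', map_add, map_mul, LinearMap.add_apply, Module.End.mul_apply, this, map_smul, hc,
      smul_smul]
    simp [add_smul]
  rw [h0, LinearMap.zero_apply] at h1
  refine (smul_eq_zero.mp h1.symm).resolve_left ?_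
  rw [Int.cast_eq_zero]
  rcases Int.units_eq_one_or u with rfl | rfl
  · simp
  · simp; omega

/-- The Betti number (the dimension of `M ⊗_ℤ ℚ`) of a Noetherian (t−1)-invertible
t-unipotent Λ-module is even. -/
theorem betti_number_even (M : Type) [AddCommGroup M] [Module Λ M] [IsNoetherian Λ M]
    (hM : Function.Bijective (fun v : M => (tL - 1) • v))
    (huni : ∃ n : ℕ, 1 ≤ n ∧ ∀ v : M, (tL ^ n) • v = v) :
    Even (Module.finrank ℚ (ℚ ⊗[ℤ] M)) := by
  have hfr : Module.finrank ℚ (ℚ ⊗[ℤ] M) = Module.finrank ℝ (ℝ ⊗[ℤ] M) := by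
    rw [← Module.finrank_baseChange (R := ℝ)]
    exact (AlgebraTensorModule.cancelBaseChange ℤ ℚ ℝ ℝ M).finrank_eq
  rw [hfr]
  by_cases hfin : Module.Finite ℝ (ℝ ⊗[ℤ] M)
  swap
  · rw [Module.finrank_of_not_finite hfin]; exact ⟨0, rfl⟩
  obtain ⟨n, hn, ht⟩ := huni
  refine real_even_degree _ (actR M tL).charpoly
    ⟨LinearMap.charpoly_natDegree _, LinearMap.charpoly_monic _⟩ ?_
  intro x hx
  rw [← Module.End.hasEigenvalue_iff_isRoot_charpoly] at hx
  obtain ⟨v, hv⟩ := hx.exists_hasEigenvector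
  have hpow : actR M tL ^ n = 1 := by
    rw [← map_pow, ← sub_eq_zero, ← map_one (actR M), ← map_sub]
    exact actR_eq_zero M _ (fun m => by rw [sub_smul, ht, one_smul, sub_self])
  have h1 := hv.pow_apply n
  rw [hpow, Module.End.one_apply] at h1
  have hxn : x ^ n = 1 := by
    have : (x ^ n - 1) • v = 0 := by rw [sub_smul, ← h1, one_smul, sub_self]
    exact sub_eq_zero.mp ((smul_eq_zero.mp this).resolve_right hv.2)
  have habs : |x| = 1 := by
    have : |x| ^ n = 1 := by rw [← abs_pow, hxn, abs_one]
    exact (pow_eq_one_iff_of_nonneg (abs_nonneg x) (by omega)).mp this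
  have happ := hv.apply_eq_smul
  rcases eq_or_eq_neg_of_abs_eq habs with rfl | rfl
  · exact hv.2 (no_eigen M hM 1 v (by simpa using happ))
  · exact hv.2 (no_eigen M hM (-1) v (by simpa using happ))
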